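/- Let (U, ω) be a complex symplectic vector space of dimension 2n, let A ∈ End(U) be nilpotent and ω-self-adjoint with Jordan block sizes n_1, n_1, n_2, n_2, …, n_k, n_k (each size of a pair, with n = n_1 + ⋯ + n_k), and let B ∈ End(U) be ω-self-adjoint, commute with A, and have exactly k distinct eigenvalues with generalized eigenspaces U_1, …, U_k. Then U = U_1 ⊕ ⋯ ⊕ U_k, this decomposition is ω-orthogonal (so each (U_i, ω|_{U_i}) is symplectic), each U_i is A-invariant, and there is a permutation σ of {1, …, k} such that dim U_i = 2 n_{σ(i)} and A|_{U_i} has exactly two Jordan blocks, each of size n_{σ(i)}. -/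

import Mathlib

open Module in
/-- The map defined by an alternating bilinear form has even rank. -/
theorem LinearMap.IsAlt.even_finrank_range {K V : Type*} [Field K] [CharZero K] [AddCommGroup V]
    [Module K V] [FiniteDimensional K V] {φ : V →ₗ[K] V →ₗ[K] K} (hφ : φ.IsAlt) :
    Even (finrank K (LinearMap.range φ)) := by
  obtain ⟨C, hC⟩ := Submodule.exists_isCompl (LinearMap.ker φ)
  have hrank : finrank K (LinearMap.range φ) = finrank K C := by
    have h1 := φ.finrank_range_add_finrank_ker
    have h2 := Submodule.finrank_add_eq_of_isCompl hC
    omega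
  let ψ : LinearMap.BilinForm K C := φ.domRestrict₁₂ C C
  have hψ (x y : C) : ψ x y = φ x y := rfl
  have hψker (x : C) (hx : ∀ y, ψ x y = 0) : x = 0 := by
    have hxk : (x : V) ∈ LinearMap.ker φ := by
      rw [LinearMap.mem_ker]
      ext y
      obtain ⟨a, ha, c, hc, rfl⟩ := Submodule.mem_sup.mp
        (hC.sup_eq_top ▸ Submodule.mem_top : y ∈ LinearMap.ker φ ⊔ C)
      have h1 : φ x a = 0 := by
        rw [← hφ.neg, LinearMap.mem_ker.mp ha]; simp
      have h2 : φ x c = 0 := hx ⟨c, hc⟩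
      simp [h1, h2]
    exact Subtype.ext (Submodule.disjoint_def.mp hC.disjoint x hxk x.2)
  have hψnd : ψ.Nondegenerate := by
    refine ⟨hψker, fun y hy => hψker y fun x => ?_⟩
    rw [hψ, ← hφ.neg, ← hψ, hy, neg_zero]
  let b := finBasis K C
  have hdet := (LinearMap.BilinForm.nondegenerate_iff_det_ne_zero b).mp hψnd
  have hskew : (LinearMap.BilinForm.toMatrix b ψ).transpose =
      -LinearMap.BilinForm.toMatrix b ψ := by
    ext i j
    simp [LinearMap.BilinForm.toMatrix_apply, hψ, hφ.neg]
  have hdet' := congrArg Matrix.det hskew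
  rw [Matrix.det_transpose, Matrix.det_neg, Fintype.card_fin] at hdet'
  rw [hrank]
  by_contra hodd
  rw [Nat.not_even_iff_odd] at hodd
  rw [hodd.neg_one_pow, neg_one_mul, eq_neg_iff_add_eq_zero, ← two_mul] at hdet'
  exact hdet (by simpa using hdet')

open Module in
/-- A self-adjoint endomorphism preserving a symplectic subspace has even rank on it. -/
theorem even_finrank_map_of_selfAdjoint {K V : Type*} [Field K] [CharZero K] [AddCommGroup V]
    [Module K V] [FiniteDimensional K V] {ω : V →ₗ[K] V →ₗ[K] K} (hω : ω.IsAlt)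
    {W : Submodule K V} (hW : ∀ x ∈ W, (∀ y ∈ W, ω x y = 0) → x = 0)
    {T : End K V} (hT : ∀ u v, ω (T u) v = ω u (T v)) (hTW : ∀ x ∈ W, T x ∈ W) :
    Even (finrank K (W.map T)) := by
  let ψ : W →ₗ[K] W →ₗ[K] K := ω.domRestrict₁₂ W W
  have hψinj : Function.Injective ψ := by
    rw [injective_iff_map_eq_zero]
    exact fun x hx => Subtype.ext (hW x x.2 fun y hy => LinearMap.congr_fun hx ⟨y, hy⟩)
  let S : W →ₗ[K] W := T.restrict hTW
  have halt : (ψ ∘ₗ S).IsAlt := fun x => by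
    have h1 : ω (T x) x = ω x (T x) := hT x x
    have h2 : -ω (T x) x = ω x (T x) := hω.neg _ _
    change ω (T x) x = 0
    rw [h1, neg_eq_iff_add_eq_zero, ← two_mul] at h2
    rw [h1]
    simpa using h2
  have h := halt.even_finrank_range
  rw [LinearMap.range_comp, ← (Submodule.equivMapOfInjective ψ hψinj _).finrank_eq] at h
  have hmap : W.map T = (LinearMap.range S).map W.subtype := by
    ext y
    simp only [S, LinearMap.range_restrict, Submodule.mem_map]
    simpa using fun x hx (hxy : T x = y) => hxy ▸ hTW x hx
  rwa [hmap, Submodule.finrank_map_subtype_eq]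

open Module in
theorem iSupIndep.finrank_iSup {K V ι : Type*} [Field K] [AddCommGroup V] [Module K V]
    [FiniteDimensional K V] [Fintype ι] {p : ι → Submodule K V} (hp : iSupIndep p) :
    finrank K (⨆ i, p i : Submodule K V) = ∑ i, finrank K (p i) := by
  classical
  rw [Submodule.iSup_eq_range_dfinsupp_lsum,
    LinearMap.finrank_range_of_inj hp.dfinsupp_lsum_injective]
  exact finrank_directSum (R := K) fun i => p i

open Module in
theorem Submodule.finrank_map_add_finrank_ker_inf {K V : Type*} [Field K] [AddCommGroup V]
    [Module K V] [FiniteDimensional K V] (T : End K V) (P : Submodule K V) :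
    finrank K P = finrank K (P.map T) + finrank K (LinearMap.ker T ⊓ P : Submodule K V) := by
  have h := (T.domRestrict P).finrank_range_add_finrank_ker
  rw [LinearMap.range_domRestrict, LinearMap.ker_domRestrict] at h
  rw [← h, ← Submodule.finrank_map_subtype_eq P (comap P.subtype (LinearMap.ker T)),
    Submodule.map_comap_subtype, inf_comm]

theorem exists_perm_comp_eq_of_card_filter_le_eq {ι : Type*} [Fintype ι] {f g : ι → ℕ}
    (h : ∀ t, (Finset.univ.filter fun i => t ≤ f i).card =
      (Finset.univ.filter fun i => t ≤ g i).card) :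
    ∃ σ : Equiv.Perm ι, ∀ i, g (σ i) = f i := by
  classical
  have key (f : ι → ℕ) (v : ℕ) : (Finset.univ.filter fun i => v ≤ f i).card =
      (Finset.univ.filter fun i => v + 1 ≤ f i).card +
        (Finset.univ.filter fun i => f i = v).card := by
    rw [← Finset.card_union_of_disjoint]
    · congr 1
      ext i
      simp
      omega
    · rw [Finset.disjoint_filter]
      intro i _ h1
      omega
  have hfib (v : ℕ) : Fintype.card {i // f i = v} = Fintype.card {i // g i = v} := by
    rw [Fintype.card_subtype, Fintype.card_subtype]
    have := key f v
    have := key g v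
    have := h v
    have := h (v + 1)
    omega
  exact ⟨Equiv.ofFiberEquiv fun v => Fintype.equivOfCardEq (hfib v), fun i =>
    Equiv.ofFiberEquiv_map _ i⟩

/-- An antitone sequence of drops taking only the values `0` and `2` is a step function. -/
theorem exists_eq_ite_of_antitone_drops {r d : ℕ → ℕ} (hrd : ∀ j, r j = r (j + 1) + d j)
    (hd : Antitone d) (h02 : ∀ j, d j = 0 ∨ d j = 2) {N : ℕ} (hN : ∀ j, N ≤ j → r j = 0) :
    ∃ m, r 0 = 2 * m ∧ ∀ j, d j = if j < m then 2 else 0 := by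
  have hex : ∃ j, d j = 0 := ⟨N, by have := hrd N; have := hN N le_rfl; omega⟩
  classical
  set m := Nat.find hex with hm
  have hm0 : d m = 0 := Nat.find_spec hex
  have hdj (j : ℕ) : d j = if j < m then 2 else 0 := by
    split_ifs with hj
    · exact (h02 j).resolve_left (Nat.find_min hex hj)
    · have := hd (not_lt.mp hj)
      omega
  refine ⟨m, ?_, hdj⟩
  have hr (j : ℕ) : r 0 = r j + 2 * min j m := by
    induction j with
    | zero => simp
    | succ j ih =>
      have h1 := hrd j
      rw [hdj j] at h1
      split_ifs at h1 <;> omega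
  have h1 := hr (N + m)
  rw [hN _ (Nat.le_add_right _ _)] at h1
  omega

theorem exists_perm_of_even_ranks {ι : Type*} [Fintype ι] {p : ι → ℕ} (hp : ∀ i, 0 < p i)
    {r d : ι → ℕ → ℕ} (hrd : ∀ i j, r i j = r i (j + 1) + d i j) (hd : ∀ i, Antitone (d i))
    (heven : ∀ i j, Even (r i j)) (hpos : ∀ i, 0 < r i 0) {N : ℕ}
    (hN : ∀ i j, N ≤ j → r i j = 0)
    (hsum : ∀ j, ∑ i, d i j = 2 * (Finset.univ.filter fun i => j + 1 ≤ p i).card) :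
    ∃ σ : Equiv.Perm ι, ∀ i, r i 0 = 2 * p (σ i) ∧
      ∀ j, d i j = if j + 1 ≤ p (σ i) then 2 else 0 := by
  have hdeven (i : ι) (j : ℕ) : Even (d i j) := by
    have h1 := heven i j
    rw [hrd i j, Nat.even_add] at h1
    exact h1.mp (heven i (j + 1))
  have hd0 (i : ι) : 2 ≤ d i 0 := by
    obtain ⟨c, hc⟩ := hdeven i 0
    by_contra hlt
    have hz (j : ℕ) : d i j = 0 := by
      have := hd i (Nat.zero_le j)
      omega
    have hconst (j : ℕ) : r i j = r i 0 := by
      induction j with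
      | zero => rfl
      | succ j ih => have := hrd i j; have := hz j; omega
    have := hconst N
    have := hN i N le_rfl
    have := hpos i
    omega
  have hd2 (i : ι) : d i 0 = 2 := by
    have h := hsum 0
    rw [Finset.filter_true_of_mem (fun i _ => Nat.succ_le_of_lt (hp i)), mul_comm, ← smul_eq_mul,
      ← Finset.sum_const] at h
    exact ((Finset.sum_eq_sum_iff_of_le fun i _ => hd0 i).mp h.symm i (Finset.mem_univ i)).symm
  have h02 (i : ι) (j : ℕ) : d i j = 0 ∨ d i j = 2 := by
    have := hd i (Nat.zero_le j)
    have := hd2 i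
    obtain ⟨c, hc⟩ := hdeven i j
    omega
  choose m hm hdm using fun i => exists_eq_ite_of_antitone_drops (hrd i) (hd i) (h02 i) (hN i)
  obtain ⟨σ, hσ⟩ := exists_perm_comp_eq_of_card_filter_le_eq (f := m) (g := p) fun t => by
    cases t with
    | zero => simp
    | succ j =>
      have h := hsum j
      simp_rw [hdm, ← Finset.sum_filter, Finset.sum_const, smul_eq_mul, ← Nat.succ_le_iff] at h
      change (Finset.univ.filter fun i => j + 1 ≤ m i).card * 2 = _ at h
      omega
  exact ⟨σ, fun i => ⟨by rw [hσ, hm], fun j => by rw [hσ, hdm]; rfl⟩⟩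

theorem pow_selfAdjoint {K V : Type*} [Field K] [AddCommGroup V] [Module K V]
    {ω : V →ₗ[K] V →ₗ[K] K} {T : Module.End K V} (hT : ∀ u v, ω (T u) v = ω u (T v)) (j : ℕ)
    (u v : V) : ω ((T ^ j) u) v = ω u ((T ^ j) v) := by
  induction j generalizing u with
  | zero => simp
  | succ j ih =>
    rw [pow_succ, Module.End.mul_apply, ih, hT, ← Module.End.mul_apply, ← pow_succ', pow_succ]

open Module in
/-- Distinct generalized eigenspaces of a self-adjoint endomorphism are orthogonal. -/
theorem apply_eq_zero_of_mem_maxGenEigenspace {K V : Type*} [Field K] [AddCommGroup V]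
    [Module K V] [FiniteDimensional K V] {ω : V →ₗ[K] V →ₗ[K] K} {T : End K V}
    (hT : ∀ u v, ω (T u) v = ω u (T v)) {a b : K} (hab : a ≠ b) {x y : V}
    (hx : x ∈ T.maxGenEigenspace a) (hy : y ∈ T.maxGenEigenspace b) : ω x y = 0 := by
  obtain ⟨N, hN⟩ := (End.mem_maxGenEigenspace T a x).mp hx
  set S := (T - a • (1 : End K V)) ^ N
  have hSsa : ∀ u v, ω (S u) v = ω u (S v) :=
    pow_selfAdjoint (fun u v => by simp [hT]) N
  have hcomm : Commute T S :=
    ((Commute.refl T).sub_right ((Commute.one_right T).smul_right a)).pow_right N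
  have hmaps := End.mapsTo_maxGenEigenspace_of_comm hcomm b
  have hinj : Function.Injective (S.restrict hmaps) := by
    rw [injective_iff_map_eq_zero]
    intro z hz
    have hza : (z : V) ∈ T.maxGenEigenspace a :=
      (End.mem_maxGenEigenspace T a z).mpr ⟨N, congrArg Subtype.val hz⟩
    exact Subtype.ext (Submodule.disjoint_def.mp
      ((End.independent_maxGenEigenspace T).pairwiseDisjoint hab) z hza z.2)
  obtain ⟨z, hz⟩ := LinearMap.injective_iff_surjective.mp hinj ⟨y, hy⟩
  have hzy : S z = y := congrArg Subtype.val hz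
  rw [← hzy, ← hSsa, hN]
  simp


theorem stmt_14 (k : ℕ) (npart : Fin k → ℕ) (hpos : ∀ i, 0 < npart i)
    (U : Type*) [AddCommGroup U] [Module ℂ U] [FiniteDimensional ℂ U]
    (n : ℕ) (hsum : ∑ i, npart i = n)
    (hdim : Module.finrank ℂ U = 2 * n)
    (ω : U →ₗ[ℂ] U →ₗ[ℂ] ℂ)
    (halt : ∀ u, ω u u = 0)
    (hnd : ∀ u, (∀ v, ω u v = 0) → u = 0)
    (A : Module.End ℂ U) (hAnil : IsNilpotent A)
    (hAsa : ∀ u v, ω (A u) v = ω u (A v))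
    -- the Jordan block sizes of `A` are `n_1, n_1, n_2, n_2, …, n_k, n_k`:
    -- for every `j ≥ 1`, the number of Jordan blocks of size `≥ j` equals
    -- `rank A^(j-1) - rank A^j`
    (hJordan : ∀ j : ℕ, 1 ≤ j →
      Module.finrank ℂ (LinearMap.range (A ^ (j - 1))) -
        Module.finrank ℂ (LinearMap.range (A ^ j)) =
      2 * (Finset.univ.filter (fun i => j ≤ npart i)).card)
    (B : Module.End ℂ U)
    (hBsa : ∀ u v, ω (B u) v = ω u (B v))
    (hcomm : A * B = B * A)
    (μ : Fin k → ℂ) (hinj : Function.Injective μ)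
    -- `B` has exactly the `k` distinct eigenvalues `μ 1, …, μ k`
    (heig : ∀ c : ℂ, Module.End.HasEigenvalue B c ↔ c ∈ Set.range μ)
    (Usub : Fin k → Submodule ℂ U)
    -- `Usub i` is the generalized eigenspace of `B` for `μ i`
    (hU : ∀ i, Usub i = LinearMap.ker ((B - μ i • 1) ^ (2 * n))) :
    DirectSum.IsInternal Usub ∧
    -- the decomposition is ω-orthogonal
    (∀ i j, i ≠ j → ∀ x ∈ Usub i, ∀ y ∈ Usub j, ω x y = 0) ∧
    -- each `(Usub i, ω|_{Usub i})` is symplectic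
    (∀ i, ∀ x ∈ Usub i, (∀ y ∈ Usub i, ω x y = 0) → x = 0) ∧
    (∀ i, ∀ x ∈ Usub i, A x ∈ Usub i) ∧
    ∃ σ : Equiv.Perm (Fin k),
      (∀ i, Module.finrank ℂ (Usub i) = 2 * npart (σ i)) ∧
      -- `A|_{Usub i}` has exactly two Jordan blocks, each of size `n_{σ i}`
      (∀ i, ∀ j : ℕ, 1 ≤ j →
        Module.finrank ℂ (Submodule.map (A ^ (j - 1)) (Usub i)) -
          Module.finrank ℂ (Submodule.map (A ^ j) (Usub i)) =
        if j ≤ npart (σ i) then 2 else 0) := by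
  have hω : ω.IsAlt := halt
  have hUB (i : Fin k) : Usub i = B.maxGenEigenspace (μ i) := by
    rw [hU i, Module.End.maxGenEigenspace_eq_genEigenspace_finrank, hdim,
      Module.End.genEigenspace_nat]
  have hind : iSupIndep Usub := by
    rw [funext hUB]
    exact (Module.End.independent_maxGenEigenspace B).comp hinj
  have htop : ⨆ i, Usub i = ⊤ := by
    rw [eq_top_iff, ← Module.End.iSup_maxGenEigenspace_eq_top B]
    refine iSup_le fun c => ?_
    by_cases hc : c ∈ Set.range μ
    · obtain ⟨i, rfl⟩ := hc
      exact (hUB i).symm.le.trans (le_iSup Usub i)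
    · rw [← heig, Module.End.hasEigenvalue_iff, not_not] at hc
      have : B.maxGenEigenspace c = ⊥ := by
        rw [Module.End.maxGenEigenspace_eq_genEigenspace_finrank, Module.End.genEigenspace_nat]
        rw [Module.End.eigenspace_def, LinearMap.ker_eq_bot] at hc
        rw [LinearMap.ker_eq_bot, Module.End.coe_pow]
        exact hc.iterate _
      rw [this]
      exact bot_le
  have horth : ∀ i j, i ≠ j → ∀ x ∈ Usub i, ∀ y ∈ Usub j, ω x y = 0 := by
    intro i j hij x hx y hy
    exact apply_eq_zero_of_mem_maxGenEigenspace hBsa (hinj.ne hij) (hUB i ▸ hx) (hUB j ▸ hy)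
  have hsymp : ∀ i, ∀ x ∈ Usub i, (∀ y ∈ Usub i, ω x y = 0) → x = 0 := by
    intro i x hx hxy
    have hle : ⨆ j, Usub j ≤ LinearMap.ker (ω x) := by
      refine iSup_le fun j y hy => ?_
      by_cases hij : i = j
      · subst hij
        exact hxy y hy
      · exact horth i j hij x hx y hy
    rw [htop] at hle
    exact hnd x fun v => hle Submodule.mem_top
  have hinv : ∀ i, ∀ x ∈ Usub i, A x ∈ Usub i := by
    intro i x hx
    rw [hUB] at hx ⊢
    exact Module.End.mapsTo_maxGenEigenspace_of_comm hcomm.symm (μ i) hx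
  have hmaple (i : Fin k) : (Usub i).map A ≤ Usub i := Submodule.map_le_iff_le_comap.mpr (hinv i)
  have hpowinv (i : Fin k) (j : ℕ) : ∀ x ∈ Usub i, (A ^ j) x ∈ Usub i := by
    intro x hx
    induction j with
    | zero => simpa
    | succ j ih =>
      rw [pow_succ', Module.End.mul_apply]
      exact hinv i _ ih
  have hmapsucc (i : Fin k) (j : ℕ) :
      (Usub i).map (A ^ (j + 1)) = ((Usub i).map (A ^ j)).map A := by
    rw [← Submodule.map_comp, ← Module.End.mul_eq_comp, ← pow_succ']
  have hdrop (i : Fin k) (j : ℕ) := by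
    have h := Submodule.finrank_map_add_finrank_ker_inf A ((Usub i).map (A ^ j))
    rwa [← hmapsucc] at h
  have hanti (i : Fin k) : Antitone fun j => Module.finrank ℂ
      (LinearMap.ker A ⊓ (Usub i).map (A ^ j) : Submodule ℂ U) := by
    refine antitone_nat_of_succ_le fun j =>
      Submodule.finrank_mono (inf_le_inf_left _ ?_)
    rw [pow_succ, Module.End.mul_eq_comp, Submodule.map_comp]
    exact Submodule.map_mono (hmaple i)
  have hrange (j : ℕ) : Module.finrank ℂ (LinearMap.range (A ^ j)) =
      ∑ i, Module.finrank ℂ ((Usub i).map (A ^ j)) := by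
    rw [← iSupIndep.finrank_iSup, ← Submodule.map_iSup, htop, Submodule.map_top]
    exact hind.mono fun i => Submodule.map_le_iff_le_comap.mpr (hpowinv i j)
  obtain ⟨N, hN⟩ := hAnil
  obtain ⟨σ, hσ⟩ := exists_perm_of_even_ranks hpos hdrop hanti
    (fun i j => even_finrank_map_of_selfAdjoint hω (hsymp i) (pow_selfAdjoint hAsa j) (hpowinv i j))
    (fun i => by
      rw [pow_zero, Module.End.one_eq_id, Submodule.map_id, Module.finrank_pos_iff,
        Submodule.nontrivial_iff_ne_bot]
      have h := (heig (μ i)).mpr ⟨i, rfl⟩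
      rw [Module.End.hasEigenvalue_iff] at h
      intro hbot
      rw [hUB] at hbot
      exact h (eq_bot_iff.mpr (Module.End.eigenspace_le_maxGenEigenspace.trans hbot.le)))
    (N := N) (fun i j hj => by
      rw [pow_eq_zero_of_le hj hN, Submodule.map_zero, finrank_bot])
    (fun j => by
      have h := hJordan (j + 1) (Nat.le_add_left 1 j)
      rw [Nat.add_sub_cancel, hrange, hrange] at h
      simp_rw [hdrop _ j] at h
      rwa [Finset.sum_add_distrib, Nat.add_sub_cancel_left] at h)
  refine ⟨DirectSum.isInternal_submodule_of_iSupIndep_of_iSup_eq_top hind htop,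
    horth, hsymp, hinv, σ, fun i => ?_, fun i j hj => ?_⟩
  · have h := (hσ i).1
    rwa [pow_zero, Module.End.one_eq_id, Submodule.map_id] at h
  · obtain ⟨j, rfl⟩ := Nat.exists_eq_add_of_le' hj
    rw [Nat.add_sub_cancel, hdrop i j, Nat.add_sub_cancel_left, (hσ i).2]
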